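/- Let w : ι₁ × ι₂ → ℂ be a unit vector (∑ z, ‖w z‖² = 1) such that (S₁ ⊗ S₂).mulVec w = ε • w for some ε ∈ ({1, −1} : Set ℂ), where S₁ ⊗ S₂ is the Kronecker product of the two parity matrices. Then there exist n : ℕ, a function p : Fin n → ℝ with p i > 0 for all i and ∑ i, p i = 1, and families u : Fin n → (ι₁ → ℂ) and v : Fin n → (ι₂ → ℂ), each orthonormal with respect to the standard Hermitian inner product, such that for each i there are signs ε₁ i, ε₂ i ∈ ({1, −1} : Set ℂ) with S₁.mulVec (u i) = ε₁ i • u i, S₂.mulVec (v i) = ε₂ i • v i and ε₁ i * ε₂ i = ε, and such that w (x, y) = ∑ i, (Real.sqrt (p i) : ℂ) * u i x * v i y for all x y. -/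

import Mathlib

open scoped Matrix Kronecker ComplexConjugate

/-- The parity matrix on `α ⊕ β`: diagonal with `+1` on `α` and `-1` on `β`. -/
noncomputable def parityMatrix (α β : Type*) [DecidableEq α] [DecidableEq β] :
    Matrix (α ⊕ β) (α ⊕ β) ℂ :=
  Matrix.diagonal (Sum.elim (fun _ => (1 : ℂ)) (fun _ => (-1 : ℂ)))

/-- A Hermitian matrix commuting with the parity matrix has a unitary diagonalization that
commutes with the parity matrix. -/
theorem exists_unitary_diagonalization_of_commute_parityMatrix {α β : Type*}
    [Fintype α] [Fintype β] [DecidableEq α] [DecidableEq β]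
    (G : Matrix (α ⊕ β) (α ⊕ β) ℂ) (hG : G.IsHermitian)
    (hc : Commute (parityMatrix α β) G) :
    ∃ (V : Matrix (α ⊕ β) (α ⊕ β) ℂ) (d : α ⊕ β → ℂ),
      Vᴴ * V = 1 ∧ Vᴴ * G * V = Matrix.diagonal d ∧ Commute (parityMatrix α β) V := by
  have hS : parityMatrix α β = Matrix.fromBlocks 1 0 0 (-1) := by
    rw [parityMatrix, ← Matrix.fromBlocks_diagonal]
    congr 1
    ext i j
    by_cases h : i = j <;> simp [h]
  obtain ⟨A, B, C, D, rfl⟩ : ∃ A B C D, G = Matrix.fromBlocks A B C D :=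
    ⟨_, _, _, _, G.fromBlocks_toBlocks.symm⟩
  have hB : B = 0 ∧ C = 0 := by
    have h := hc.eq
    rw [hS, Matrix.fromBlocks_multiply, Matrix.fromBlocks_multiply, Matrix.fromBlocks_inj] at h
    obtain ⟨-, h₁, h₂, -⟩ := h
    simp only [Matrix.one_mul, Matrix.mul_one, Matrix.zero_mul, Matrix.mul_zero,
      Matrix.neg_mul, Matrix.mul_neg, add_zero, zero_add] at h₁ h₂
    exact ⟨Matrix.ext fun i j => self_eq_neg.mp (congrFun (congrFun h₁ i) j),
      Matrix.ext fun i j => neg_eq_self.mp (congrFun (congrFun h₂ i) j)⟩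
  obtain ⟨rfl, rfl⟩ := hB
  obtain ⟨hA, -, -, hD⟩ := Matrix.isHermitian_fromBlocks_iff.mp hG
  have hUA : (hA.eigenvectorUnitary : Matrix α α ℂ)ᴴ * hA.eigenvectorUnitary = 1 :=
    Unitary.coe_star_mul_self _
  have hUD : (hD.eigenvectorUnitary : Matrix β β ℂ)ᴴ * hD.eigenvectorUnitary = 1 :=
    Unitary.coe_star_mul_self _
  have hdA := hA.conjStarAlgAut_star_eigenvectorUnitary
  have hdD := hD.conjStarAlgAut_star_eigenvectorUnitary
  rw [Unitary.conjStarAlgAut_star_apply, Matrix.star_eq_conjTranspose] at hdA hdD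
  refine ⟨Matrix.fromBlocks hA.eigenvectorUnitary 0 0 hD.eigenvectorUnitary,
    Sum.elim (RCLike.ofReal ∘ hA.eigenvalues) (RCLike.ofReal ∘ hD.eigenvalues), ?_, ?_, ?_⟩
  · simp [Matrix.fromBlocks_conjTranspose, Matrix.fromBlocks_multiply, hUA, hUD]
  · simp [Matrix.fromBlocks_conjTranspose, Matrix.fromBlocks_multiply, hdA, hdD,
      Matrix.fromBlocks_diagonal]
  · simp [Commute, SemiconjBy, hS, Matrix.fromBlocks_multiply]

theorem parityMatrix_conjTranspose (α β : Type*) [DecidableEq α] [DecidableEq β] :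
    (parityMatrix α β)ᴴ = parityMatrix α β := by
  rw [parityMatrix, Matrix.diagonal_conjTranspose]
  congr 1
  ext (i | i) <;> simp

theorem parityMatrix_mul_self (α β : Type*) [Fintype α] [Fintype β]
    [DecidableEq α] [DecidableEq β] : parityMatrix α β * parityMatrix α β = 1 := by
  rw [parityMatrix, Matrix.diagonal_mul_diagonal, ← Matrix.diagonal_one]
  congr 1
  ext (i | i) <;> simp

/-- Schmidt decomposition for pure bipartite fermionic states obeying the parity
super-selection rule. -/
theorem parity_schmidt_decomposition
    {α₁ β₁ α₂ β₂ : Type*} [Fintype α₁] [Fintype β₁] [Fintype α₂] [Fintype β₂]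
    [DecidableEq α₁] [DecidableEq β₁] [DecidableEq α₂] [DecidableEq β₂]
    (w : ((α₁ ⊕ β₁) × (α₂ ⊕ β₂)) → ℂ)
    (hw_unit : ∑ z, ‖w z‖ ^ 2 = 1)
    (ε : ℂ) (hε : ε ∈ ({1, -1} : Set ℂ))
    (hw_par : (parityMatrix α₁ β₁ ⊗ₖ parityMatrix α₂ β₂).mulVec w = ε • w) :
    ∃ (n : ℕ) (p : Fin n → ℝ)
      (u : Fin n → ((α₁ ⊕ β₁) → ℂ)) (v : Fin n → ((α₂ ⊕ β₂) → ℂ))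
      (ε₁ ε₂ : Fin n → ℂ),
      (∀ i, 0 < p i) ∧ (∑ i, p i = 1) ∧
      (∀ i j, ∑ x, conj (u i x) * u j x = if i = j then 1 else 0) ∧
      (∀ i j, ∑ y, conj (v i y) * v j y = if i = j then 1 else 0) ∧
      (∀ i, ε₁ i ∈ ({1, -1} : Set ℂ) ∧ ε₂ i ∈ ({1, -1} : Set ℂ) ∧
        (parityMatrix α₁ β₁).mulVec (u i) = ε₁ i • u i ∧
        (parityMatrix α₂ β₂).mulVec (v i) = ε₂ i • v i ∧
        ε₁ i * ε₂ i = ε) ∧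
      (∀ x y, w (x, y) = ∑ i, (Real.sqrt (p i) : ℂ) * u i x * v i y) := by
  classical
  set S₁ := parityMatrix α₁ β₁
  set S₂ := parityMatrix α₂ β₂
  let π₁ : α₁ ⊕ β₁ → ℂ := Sum.elim (fun _ => 1) (fun _ => -1)
  let π₂ : α₂ ⊕ β₂ → ℂ := Sum.elim (fun _ => 1) (fun _ => -1)
  have hS₁' : S₁ = Matrix.diagonal π₁ := rfl
  have hS₂' : S₂ = Matrix.diagonal π₂ := rfl
  have hπ₂ : ∀ k, π₂ k ∈ ({1, -1} : Set ℂ) := by rintro (k | k) <;> simp [π₂]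
  have hmem : ∀ a ∈ ({1, -1} : Set ℂ), a * a = 1 ∧ conj a = a := by
    rintro a (rfl | rfl) <;> simp
  let M : Matrix (α₁ ⊕ β₁) (α₂ ⊕ β₂) ℂ := Matrix.of fun x y => w (x, y)
  have hM : S₁ * M * S₂ = ε • M := by
    ext x y
    have h := congrFun hw_par (x, y)
    rw [hS₁', hS₂', Matrix.diagonal_kronecker_diagonal, Matrix.mulVec_diagonal] at h
    rw [hS₁', hS₂', Matrix.mul_diagonal, Matrix.diagonal_mul]
    simp only [M, Matrix.of_apply, Matrix.smul_apply, Pi.smul_apply] at h ⊢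
    rw [← h]
    ring
  have hSM : S₁ * M = ε • (M * S₂) := by
    rw [← Matrix.smul_mul, ← hM, Matrix.mul_assoc, parityMatrix_mul_self, Matrix.mul_one]
  have hMS : Mᴴ * S₁ = ε • (S₂ * Mᴴ) := by
    have h := congrArg Matrix.conjTranspose hSM
    rwa [Matrix.conjTranspose_mul, Matrix.conjTranspose_smul, Matrix.conjTranspose_mul,
      parityMatrix_conjTranspose, parityMatrix_conjTranspose, ← starRingEnd_apply,
      (hmem ε hε).2] at h
  have hcomm : Commute S₂ (Mᴴ * M) := by
    have h : Mᴴ * S₁ * M = Mᴴ * (S₁ * M) := Matrix.mul_assoc _ _ _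
    rw [hMS, hSM, Matrix.smul_mul, Matrix.mul_smul] at h
    have h' := congrArg (ε • ·) h
    simpa [smul_smul, (hmem ε hε).1, Commute, SemiconjBy, Matrix.mul_assoc] using h'
  obtain ⟨V, d, hV, hd, hVS⟩ := exists_unitary_diagonalization_of_commute_parityMatrix
    (Mᴴ * M) (Matrix.isHermitian_conjTranspose_mul_self M) hcomm
  have hV' : V * Vᴴ = 1 := mul_eq_one_comm.mp hV
  let N := M * V
  let l : α₂ ⊕ β₂ → ℝ := fun k => ∑ x, ‖N x k‖ ^ 2
  have hNd : Nᴴ * N = Matrix.diagonal d := by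
    rw [← hd, Matrix.conjTranspose_mul]
    simp only [N, Matrix.mul_assoc]
  have hsum : ∀ i j, ∑ x, conj (N x i) * N x j = if i = j then (l i : ℂ) else 0 := by
    intro i j
    split_ifs with h
    · subst h
      simp only [l, Complex.conj_mul', Complex.ofReal_sum, Complex.ofReal_pow]
    · have h' := congrFun (congrFun hNd i) j
      rwa [Matrix.diagonal_apply_ne _ h, Matrix.mul_apply] at h'
  have hl_nonneg : ∀ k, 0 ≤ l k := fun k => Finset.sum_nonneg fun x _ => sq_nonneg _
  have hN_zero : ∀ k, l k = 0 → ∀ x, N x k = 0 := by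
    intro k hk x
    have h := (Finset.sum_eq_zero_iff_of_nonneg fun x _ => sq_nonneg ‖N x k‖).mp hk x
      (Finset.mem_univ x)
    simpa using h
  have hl_sum : ∑ k, l k = 1 := by
    have htr : (Nᴴ * N).trace = (Mᴴ * M).trace := by
      rw [Matrix.conjTranspose_mul, Matrix.mul_assoc, Matrix.trace_mul_comm,
        Matrix.mul_assoc, Matrix.mul_assoc, hV', Matrix.mul_one]
    have hM_tr : (Mᴴ * M).trace = 1 := by
      simp only [Matrix.trace, Matrix.diag_apply, Matrix.mul_apply, Matrix.conjTranspose_apply,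
        ← starRingEnd_apply, Complex.conj_mul', M, Matrix.of_apply]
      rw [Finset.sum_comm, ← Fintype.sum_prod_type' fun x y => (‖w (x, y)‖ : ℂ) ^ 2]
      exact_mod_cast hw_unit
    have hN_tr : (Nᴴ * N).trace = ((∑ k, l k : ℝ) : ℂ) := by
      simp only [Matrix.trace, Matrix.diag_apply, Matrix.mul_apply, Matrix.conjTranspose_apply,
        ← starRingEnd_apply, hsum, if_true, Complex.ofReal_sum]
    exact_mod_cast hN_tr.symm.trans (htr.trans hM_tr)
  have hNpar : ∀ x k, π₁ x * N x k = ε * π₂ k * N x k := by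
    intro x k
    have h : S₁ * N = ε • (N * S₂) := by
      simp only [N]
      rw [← Matrix.mul_assoc, hSM, Matrix.smul_mul, Matrix.mul_assoc, hVS.eq, Matrix.mul_assoc]
    have h' := congrFun (congrFun h x) k
    rw [hS₁', hS₂', Matrix.diagonal_mul, Matrix.smul_apply, Matrix.mul_diagonal,
      smul_eq_mul] at h'
    rw [h']
    ring
  have hVpar : ∀ y k, π₂ y * V y k = π₂ k * V y k := by
    intro y k
    have h' := congrFun (congrFun hVS.eq y) k
    change (S₂ * V) y k = (V * S₂) y k at h'
    rw [hS₂', Matrix.diagonal_mul, Matrix.mul_diagonal] at h'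
    rw [h', mul_comm]
  let e := (Fintype.equivFin {k // 0 < l k}).symm
  have hinj : ∀ i j, (e i : α₂ ⊕ β₂) = e j ↔ i = j := fun i j =>
    Subtype.val_injective.eq_iff.trans e.injective.eq_iff
  have hsq : ∀ i, (Real.sqrt (l (e i)) : ℂ) ≠ 0 := fun i =>
    Complex.ofReal_ne_zero.mpr (Real.sqrt_pos.mpr (e i).2).ne'
  have hsupp : ∀ {R : Type} [AddCommMonoid R] (f : α₂ ⊕ β₂ → R), (∀ k, l k = 0 → f k = 0) →
      ∑ i, f (e i) = ∑ k, f k := by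
    intro R _ f hf
    rw [e.sum_comp fun k : {k // 0 < l k} => f k,
      ← Finset.sum_subtype (Finset.univ.filter fun k => 0 < l k) (by simp) f]
    refine Finset.sum_filter_of_ne fun k _ hk => (hl_nonneg k).lt_of_ne' fun h => hk (hf k h)
  refine ⟨_, fun i => l (e i), fun i x => N x (e i) / Real.sqrt (l (e i)),
    fun i y => conj (V y (e i)), fun i => ε * π₂ (e i), fun i => π₂ (e i),
    fun i => (e i).2, ?_, ?_, ?_, fun i => ⟨?_, hπ₂ _, ?_, ?_, ?_⟩, ?_⟩
  · rw [hsupp l fun _ h => h, hl_sum]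
  · intro i j
    simp only [map_div₀, Complex.conj_ofReal, div_mul_div_comm]
    rw [← Finset.sum_div, hsum]
    simp only [hinj]
    split_ifs with h
    · subst h
      rw [← Complex.ofReal_mul, Real.mul_self_sqrt (hl_nonneg _)]
      exact div_self (Complex.ofReal_ne_zero.mpr (e i).2.ne')
    · simp
  · intro i j
    have h := congrFun (congrFun hV (e j)) (e i)
    rw [Matrix.mul_apply, Matrix.one_apply] at h
    simp only [hinj, Matrix.conjTranspose_apply, ← starRingEnd_apply] at h
    simp only [Complex.conj_conj, eq_comm (a := i)]
    rw [← h]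
    exact Finset.sum_congr rfl fun _ _ => mul_comm _ _
  · rcases hε with rfl | rfl <;> rcases hπ₂ (e i) with (h : _ = _) | (h : _ = _) <;> simp [h]
  · ext x
    rw [hS₁', Matrix.mulVec_diagonal, Pi.smul_apply, smul_eq_mul, ← mul_div_assoc, hNpar,
      mul_div_assoc]
  · ext y
    have h := congrArg conj (hVpar y (e i))
    rw [map_mul, map_mul, (hmem _ (hπ₂ y)).2, (hmem _ (hπ₂ (e i))).2] at h
    rw [hS₂', Matrix.mulVec_diagonal, h, Pi.smul_apply, smul_eq_mul]
  · rw [mul_assoc, (hmem _ (hπ₂ (e i))).1, mul_one]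
  · intro x y
    have h : M = N * Vᴴ := by rw [Matrix.mul_assoc, hV', Matrix.mul_one]
    calc w (x, y) = ∑ k, N x k * conj (V y k) := congrFun (congrFun h x) y
      _ = ∑ i, N x (e i) * conj (V y (e i)) :=
        (hsupp (fun k => N x k * conj (V y k)) fun k hk => by simp [hN_zero k hk x]).symm
      _ = _ := Finset.sum_congr rfl fun i _ => by rw [mul_div_cancel₀ _ (hsq i)]
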